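/- Let G be a finite group, let B be a non-splitting Rota–Baxter operator on G, and suppose that R = Im(B) ∩ Im(B̃) has prime cardinality. Then G = ker(B)·Im(B) is an exact factorization, or G = ker(B̃)·Im(B̃) is an exact factorization. -/

import Mathlib

/-- A Rota–Baxter operator of weight 1 on a group. -/
def IsRotaBaxter {G : Type*} [Group G] (B : G → G) : Prop :=
  ∀ g h : G, B g * B h = B (g * B g * h * (B g)⁻¹)

/-- A splitting Rota–Baxter operator: comes from an exact factorization G = HL. -/
def IsSplitting {G : Type*} [Group G] (B : G → G) : Prop :=
  ∃ H L : Subgroup G, H ⊓ L = ⊥ ∧ (∀ g : G, ∃ h ∈ H, ∃ l ∈ L, g = h * l) ∧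
    (∀ h ∈ H, ∀ l ∈ L, B (h * l) = l⁻¹)

/-- The companion Rota–Baxter operator B̃(g) = g⁻¹ · B(g⁻¹). -/
def tilde {G : Type*} [Group G] (B : G → G) : G → G := fun g => g⁻¹ * B g⁻¹

namespace IsRotaBaxter

variable {G : Type*} [Group G] {B : G → G}

theorem map_one (hB : IsRotaBaxter B) : B 1 = 1 := by
  have h := hB 1 1
  simpa using h

theorem map_mul_of_map_eq_one (hB : IsRotaBaxter B) {k : G} (hk : B k = 1) (h : G) :
    B (k * h) = B h := by
  have := hB k h
  simpa [hk] using this.symm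

theorem map_conj_div_eq_one (hB : IsRotaBaxter B) {a b : G} (hab : B a = B b) :
    B ((B b)⁻¹ * (b⁻¹ * a) * B b) = 1 := by
  have h := hB b ((B b)⁻¹ * (b⁻¹ * a) * B b)
  have e : b * B b * ((B b)⁻¹ * (b⁻¹ * a) * B b) * (B b)⁻¹ = a := by group
  rw [e, hab] at h
  exact mul_eq_left.mp h

/-- The range of a Rota–Baxter operator, as a subgroup. -/
def range (hB : IsRotaBaxter B) : Subgroup G where
  carrier := Set.range B
  one_mem' := ⟨1, hB.map_one⟩
  mul_mem' := by
    rintro _ _ ⟨g, rfl⟩ ⟨h, rfl⟩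
    exact ⟨_, (hB g h).symm⟩
  inv_mem' := by
    rintro _ ⟨g, rfl⟩
    refine ⟨(B g)⁻¹ * g⁻¹ * B g, ?_⟩
    have h := hB g ((B g)⁻¹ * g⁻¹ * B g)
    have e : g * B g * ((B g)⁻¹ * g⁻¹ * B g) * (B g)⁻¹ = 1 := by group
    rw [e, hB.map_one] at h
    exact eq_inv_of_mul_eq_one_right h

/-- The kernel of a Rota–Baxter operator, as a subgroup. -/
def ker (hB : IsRotaBaxter B) : Subgroup G where
  carrier := {g | B g = 1}
  one_mem' := hB.map_one
  mul_mem' := fun {a b} ha hb => (hB.map_mul_of_map_eq_one ha b).trans hb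
  inv_mem' := fun {a} ha => by
    have h := hB.map_mul_of_map_eq_one ha a⁻¹
    rw [mul_inv_cancel, hB.map_one] at h
    exact h.symm

theorem tilde (hB : IsRotaBaxter B) : IsRotaBaxter (tilde B) := by
  intro g h
  have e : (g * (g⁻¹ * B g⁻¹) * h * (g⁻¹ * B g⁻¹)⁻¹)⁻¹ =
      g⁻¹ * B g⁻¹ * h⁻¹ * (B g⁻¹)⁻¹ := by group
  simp only [_root_.tilde]
  rw [e, ← hB]
  group

/-- If kernel and range meet trivially, their product is the whole finite group. -/
theorem exists_eq_mul [Finite G] (hB : IsRotaBaxter B)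
    (hd : ∀ g : G, B g = 1 → g ∈ Set.range B → g = 1) (g : G) :
    ∃ k, B k = 1 ∧ ∃ l ∈ Set.range B, g = k * l := by
  choose s hs using fun x : Set.range B => x.2
  let c : G → G := fun a =>
    (B a)⁻¹ * ((s ⟨B a, a, rfl⟩)⁻¹ * a) * B a
  have hc (a : G) : B (c a) = 1 := by
    have hsa : B (s ⟨B a, a, rfl⟩) = B a := hs ⟨B a, a, rfl⟩
    have h := hB.map_conj_div_eq_one hsa.symm
    rwa [hsa] at h
  have hinj : Function.Injective fun a => c a * B a := by
    intro a b hab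
    have hab : c a * B a = c b * B b := hab
    have e : (c b)⁻¹ * c a = B b * (B a)⁻¹ := by
      rw [eq_mul_inv_iff_mul_eq, mul_assoc, hab, inv_mul_cancel_left]
    have h1 : (c b)⁻¹ * c a = 1 := by
      refine hd _ (hB.ker.mul_mem (hB.ker.inv_mem (hc b)) (hc a)) ?_
      rw [e]
      exact hB.range.mul_mem ⟨b, rfl⟩ (hB.range.inv_mem ⟨a, rfl⟩)
    have hcc : c a = c b := (inv_mul_eq_one.mp h1).symm
    have hBB : B a = B b := by rw [hcc] at hab; exact mul_left_cancel hab
    simp only [c, hBB] at hcc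
    exact mul_left_cancel (mul_left_cancel (mul_right_cancel hcc))
  obtain ⟨a, rfl⟩ := Finite.surjective_of_injective hinj g
  exact ⟨c a, hc a, B a, ⟨a, rfl⟩, rfl⟩

end IsRotaBaxter

/-- For a non-splitting Rota–Baxter operator B on a finite group with |Im(B) ∩ Im(B̃)| prime,
G = ker(B)·Im(B) or G = ker(B̃)·Im(B̃) is an exact factorization. -/
theorem stmt16 {G : Type*} [Group G] [Finite G] (B : G → G) (hB : IsRotaBaxter B)
    (hns : ¬ IsSplitting B)
    (hprime : Nat.Prime ((Set.range B ∩ Set.range (tilde B)).ncard)) :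
    ((∀ g : G, B g = 1 → g ∈ Set.range B → g = 1) ∧
      (∀ g : G, ∃ k, B k = 1 ∧ ∃ l ∈ Set.range B, g = k * l)) ∨
    ((∀ g : G, tilde B g = 1 → g ∈ Set.range (tilde B) → g = 1) ∧
      (∀ g : G, ∃ k, tilde B k = 1 ∧ ∃ l ∈ Set.range (tilde B), g = k * l)) := by
  by_cases h1 : ∀ g : G, B g = 1 → g ∈ Set.range B → g = 1
  · exact Or.inl ⟨h1, hB.exists_eq_mul h1⟩
  by_cases h2 : ∀ g : G, tilde B g = 1 → g ∈ Set.range (tilde B) → g = 1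
  · exact Or.inr ⟨h2, hB.tilde.exists_eq_mul h2⟩
  exfalso
  push Not at h1 h2
  obtain ⟨x, hx, hxr, hx1⟩ := h1
  obtain ⟨y, hy, hyr, hy1⟩ := h2
  have hBy : B y⁻¹ = y := (inv_mul_eq_one.mp hy).symm
  let R : Subgroup G := hB.range ⊓ hB.tilde.range
  have hxR : x ∈ R := ⟨hxr, x⁻¹, by simp [tilde, hx]⟩
  have hyR : y ∈ R := ⟨⟨y⁻¹, hBy⟩, hyr⟩
  have hcard : Nat.card R = (Set.range B ∩ Set.range (tilde B)).ncard := rfl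
  have : Fact (Nat.Prime (Set.range B ∩ Set.range (tilde B)).ncard) := ⟨hprime⟩
  have hmem : (⟨y, hyR⟩ : R) ∈ Subgroup.zpowers (⟨x, hxR⟩ : R) :=
    mem_zpowers_of_prime_card hcard fun h => hx1 (congrArg Subtype.val h)
  obtain ⟨n, hn⟩ := hmem
  have hn : x ^ n = y := congrArg Subtype.val hn
  have hyk : y ∈ hB.ker := hn ▸ hB.ker.zpow_mem hx n
  exact hy1 (hBy.symm.trans (hB.ker.inv_mem hyk))
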